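/- (Sparse Carleson embedding for A∞ weights.) Let ω be a weight on ℝⁿ with [ω]_{A∞} < ∞, let 𝒮 be an η-sparse collection of dyadic cubes, and let R be a cube. Then Σ_{Q∈𝒮, Q⊆R} ω(Q) ≤ η^{−1} [ω]_{A∞} ω(R). More precisely, Σ_{Q∈𝒮, Q⊆R} ∫_Q ω ≤ Σ_{Q∈𝒮, Q⊆R} |Q| inf_{E_Q} M(1_Q ω) ≤ η^{−1} ∫_R M(1_R ω) ≤ η^{−1} [ω]_{A∞} ω(R), where (E_Q)_{Q∈𝒮} are the pairwise disjoint sets witnessing sparseness. -/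

import Mathlib

open MeasureTheory ENNReal Set

noncomputable section

/-- An axis-parallel (closed) cube in ℝⁿ with corner `corner` and side length `side > 0`. -/
structure Cube (n : ℕ) where
  corner : Fin n → ℝ
  side : ℝ
  side_pos : 0 < side

namespace Cube

/-- The set of points of the cube. -/
def carrier {n : ℕ} (Q : Cube n) : Set (Fin n → ℝ) :=
  {x | ∀ i, Q.corner i ≤ x i ∧ x i ≤ Q.corner i + Q.side}

/-- The volume `|Q|` of the cube. -/
def vol {n : ℕ} (Q : Cube n) : ℝ := Q.side ^ n

/-- `Q` is a cube of the standard dyadic grid: `Q = 2^{-j}([0,1]^n + m)`. -/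
def IsDyadic {n : ℕ} (Q : Cube n) : Prop :=
  ∃ (j : ℤ) (m : Fin n → ℤ),
    Q.side = (2 : ℝ) ^ (-j) ∧ ∀ i, Q.corner i = (m i : ℝ) * (2 : ℝ) ^ (-j)

end Cube

/-- `η`-sparseness of a collection of cubes: there are pairwise disjoint measurable
subsets `E Q ⊆ Q` with `|E Q| ≥ η |Q|`. -/
def IsSparse {n : ℕ} (η : ℝ) (S : Set (Cube n)) : Prop :=
  ∃ E : Cube n → Set (Fin n → ℝ),
    (∀ Q ∈ S, MeasurableSet (E Q)) ∧ (∀ Q ∈ S, E Q ⊆ Q.carrier) ∧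
    (S.Pairwise (fun Q Q' => Disjoint (E Q) (E Q'))) ∧
    (∀ Q ∈ S, ENNReal.ofReal (η * Q.vol) ≤ volume (E Q))

/-- A weight: a nonnegative locally integrable function on ℝⁿ. -/
def IsWeight {n : ℕ} (w : (Fin n → ℝ) → ℝ) : Prop :=
  MeasureTheory.LocallyIntegrable w volume ∧ ∀ x, 0 ≤ w x

/-- `ω(Q) = ∫_Q ω`. -/
def wMass {n : ℕ} (w : (Fin n → ℝ) → ℝ) (Q : Cube n) : ℝ≥0∞ :=
  ∫⁻ x in Q.carrier, ENNReal.ofReal (w x)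

/-- The weighted `L^s` (quasi)norm `‖f‖_{L^s_w} = (∫ |f|^s w)^{1/s}`, valued in `ℝ≥0∞`. -/
def wNorm {n : ℕ} (s : ℝ) (w f : (Fin n → ℝ) → ℝ) : ℝ≥0∞ :=
  (∫⁻ x, ENNReal.ofReal (|f x| ^ s) * ENNReal.ofReal (w x)) ^ (1 / s)

/-- The weighted `L^s` (quasi)norm of an `ℝ≥0∞`-valued function. -/
def eNorm {n : ℕ} (s : ℝ) (w : (Fin n → ℝ) → ℝ) (g : (Fin n → ℝ) → ℝ≥0∞) : ℝ≥0∞ :=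
  (∫⁻ x, g x ^ s * ENNReal.ofReal (w x)) ^ (1 / s)

/-- `Σ_{Q ∈ D} g(Q) 1_Q`. -/
def cubeSum {n : ℕ} (D : Set (Cube n)) (g : Cube n → ℝ≥0∞) (x : Fin n → ℝ) : ℝ≥0∞ :=
  ∑' Q : D, Q.1.carrier.indicator (fun _ => g Q.1) x

/-- The sparse operator `A^{r,α}_S f = (Σ_{Q∈S} (|Q|^{-α} ∫_Q f)^r 1_Q)^{1/r}`
(for nonnegative `f`; negative values are truncated). -/
def sparseOp {n : ℕ} (S : Set (Cube n)) (r α : ℝ) (f : (Fin n → ℝ) → ℝ)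
    (x : Fin n → ℝ) : ℝ≥0∞ :=
  (cubeSum S
      (fun Q => ((ENNReal.ofReal Q.vol) ^ (-α) * ∫⁻ y in Q.carrier, ENNReal.ofReal (f y)) ^ r)
      x) ^ (1 / r)

/-- The Hardy–Littlewood maximal function over axis-parallel cubes. -/
def maximal {n : ℕ} (w : (Fin n → ℝ) → ℝ) (x : Fin n → ℝ) : ℝ≥0∞ :=
  ⨆ (Q : Cube n) (_ : x ∈ Q.carrier),
    (ENNReal.ofReal Q.vol)⁻¹ * ∫⁻ y in Q.carrier, ENNReal.ofReal |w y|

/-- The Fujii–Wilson `A∞`-characteristic `[w]_{A∞} = sup_Q ω(Q)⁻¹ ∫_Q M(1_Q ω)`. -/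
def AinfChar {n : ℕ} (w : (Fin n → ℝ) → ℝ) : ℝ≥0∞ :=
  ⨆ Q : Cube n, (wMass w Q)⁻¹ * ∫⁻ x in Q.carrier, maximal (Q.carrier.indicator w) x

/-- The two-weight characteristic
`[ω,σ]_{A^α_{pq}(S)} = sup_{Q∈S} |Q|^{-α} ω(Q)^{1/q} σ(Q)^{1/p'}` (here `1/p' = 1 - 1/p`). -/
def twoWeightChar {n : ℕ} (p q α : ℝ) (S : Set (Cube n)) (w σ' : (Fin n → ℝ) → ℝ) : ℝ≥0∞ :=
  ⨆ Q ∈ S, (ENNReal.ofReal Q.vol) ^ (-α) * wMass w Q ^ (1 / q) * wMass σ' Q ^ (1 - 1 / p)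

/-- The one-weight characteristic
`[w]_{A_{pq}} = sup_Q (|Q|⁻¹ ∫_Q w^q)(|Q|⁻¹ ∫_Q w^{-p'})^{q/p'}`, `p' = p/(p-1)`. -/
def ApqChar {n : ℕ} (p q : ℝ) (w : (Fin n → ℝ) → ℝ) : ℝ≥0∞ :=
  ⨆ Q : Cube n,
    ((ENNReal.ofReal Q.vol)⁻¹ * ∫⁻ x in Q.carrier, (ENNReal.ofReal (w x)) ^ q) *
      ((ENNReal.ofReal Q.vol)⁻¹ *
          ∫⁻ x in Q.carrier, (ENNReal.ofReal (w x)) ^ (-(p / (p - 1)))) ^ (q / (p / (p - 1)))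

/-- The testing constant `𝒯`. -/
def testT {n : ℕ} (p q r α : ℝ) (S : Set (Cube n)) (w σ' : (Fin n → ℝ) → ℝ) : ℝ≥0∞ :=
  ⨆ R ∈ S,
    wMass σ' R ^ (-(r / p)) *
      eNorm (q / r) w
        (cubeSum {Q | Q ∈ S ∧ Q.carrier ⊆ R.carrier}
          (fun Q => (ENNReal.ofReal Q.vol) ^ (-(α * r)) * wMass σ' Q ^ r))

/-- The testing constant `𝒯*`; here `1/(q/r)' = 1 - r/q` and `(p/r)' = (p/r)/((p/r)-1)`. -/
def testTstar {n : ℕ} (p q r α : ℝ) (S : Set (Cube n)) (w σ' : (Fin n → ℝ) → ℝ) : ℝ≥0∞ :=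
  ⨆ R ∈ S,
    wMass w R ^ (-(1 - r / q)) *
      eNorm ((p / r) / (p / r - 1)) σ'
        (cubeSum {Q | Q ∈ S ∧ Q.carrier ⊆ R.carrier}
          (fun Q => (ENNReal.ofReal Q.vol) ^ (-(α * r)) * wMass σ' Q ^ (r - 1) * wMass w Q))

/-- The operator (quasi)norm of `A^{r,α}_S(·σ) : L^p_σ → L^q_ω`, i.e. the least constant `K`
with `‖A^{r,α}_S(fσ)‖_{L^q_ω} ≤ K ‖f‖_{L^p_σ}` for all `f`. -/
def sparseOpNorm {n : ℕ} (p q r α : ℝ) (S : Set (Cube n)) (w σ' : (Fin n → ℝ) → ℝ) : ℝ≥0∞ :=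
  sInf {K : ℝ≥0∞ | ∀ f : (Fin n → ℝ) → ℝ, Measurable f →
    eNorm q w (sparseOp S r α (fun y => f y * σ' y)) ≤ K * wNorm p σ' f}

namespace Cube

variable {n : ℕ}

lemma carrier_eq_Icc (Q : Cube n) :
    Q.carrier = Icc Q.corner (fun i => Q.corner i + Q.side) := by
  ext x
  simp [carrier, Pi.le_def, forall_and]

lemma measurableSet_carrier (Q : Cube n) : MeasurableSet Q.carrier := by
  rw [carrier_eq_Icc]
  exact measurableSet_Icc

lemma isCompact_carrier (Q : Cube n) : IsCompact Q.carrier := by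
  rw [carrier_eq_Icc]
  exact isCompact_Icc

lemma vol_pos (Q : Cube n) : 0 < Q.vol := pow_pos Q.side_pos n

end Cube

section SparseCarleson

variable {n : ℕ} {w : (Fin n → ℝ) → ℝ}

lemma wMass_mono {Q R : Cube n} (h : Q.carrier ⊆ R.carrier) : wMass w Q ≤ wMass w R :=
  lintegral_mono_set h

lemma wMass_lt_top (hw : IsWeight w) (Q : Cube n) : wMass w Q < ∞ :=
  (hw.1.integrableOn_isCompact Q.isCompact_carrier).lintegral_lt_top

/-- On a subcube `Q` of `R`, the maximal function of `1_R w` is at least the average of `w`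
over `Q`. -/
lemma average_le_maximal_indicator (hw : ∀ x, 0 ≤ w x) {Q R : Cube n}
    (h : Q.carrier ⊆ R.carrier) {x : Fin n → ℝ} (hx : x ∈ Q.carrier) :
    (ENNReal.ofReal Q.vol)⁻¹ * wMass w Q ≤ maximal (R.carrier.indicator w) x := by
  refine le_trans (le_of_eq ?_) (le_iSup₂ (f := fun (P : Cube n) (_ : x ∈ P.carrier) =>
    (ENNReal.ofReal P.vol)⁻¹ *
      ∫⁻ y in P.carrier, ENNReal.ofReal |R.carrier.indicator w y|) Q hx)
  congr 1
  refine setLIntegral_congr_fun Q.measurableSet_carrier fun y hy => ?_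
  simp only [indicator_of_mem (h hy), abs_of_nonneg (hw y)]

lemma lintegral_maximal_le_AinfChar_mul (hw : IsWeight w) {R : Cube n} (hR : wMass w R ≠ 0) :
    ∫⁻ x in R.carrier, maximal (R.carrier.indicator w) x ≤ AinfChar w * wMass w R := by
  rw [← ENNReal.div_le_iff hR (wMass_lt_top hw R).ne, ENNReal.div_eq_inv_mul]
  exact le_iSup (fun Q : Cube n =>
    (wMass w Q)⁻¹ * ∫⁻ x in Q.carrier, maximal (Q.carrier.indicator w) x) R

/-- If `E ⊆ Q ⊆ R` and `|E| ≥ η |Q|`, the mass of `Q` is controlled by the integral over `E` of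
the maximal function of `1_R w`. -/
lemma wMass_le_lintegral_maximal {η : ℝ} (hη : 0 < η) (hw : ∀ x, 0 ≤ w x) {Q R : Cube n}
    (h : Q.carrier ⊆ R.carrier) {E : Set (Fin n → ℝ)} (hE : MeasurableSet E)
    (hEQ : E ⊆ Q.carrier) (hvol : ENNReal.ofReal (η * Q.vol) ≤ volume E) :
    wMass w Q ≤ ENNReal.ofReal η⁻¹ * ∫⁻ x in E, maximal (R.carrier.indicator w) x := by
  have hv : ENNReal.ofReal Q.vol ≠ 0 := (ENNReal.ofReal_pos.2 Q.vol_pos).ne'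
  have hη0 : ENNReal.ofReal η ≠ 0 := (ENNReal.ofReal_pos.2 hη).ne'
  rw [ENNReal.ofReal_inv_of_pos hη, ← ENNReal.mul_le_iff_le_inv hη0 ofReal_ne_top]
  calc ENNReal.ofReal η * wMass w Q
      = (ENNReal.ofReal Q.vol)⁻¹ * wMass w Q * ENNReal.ofReal (η * Q.vol) := by
        have hcancel := ENNReal.inv_mul_cancel hv ofReal_ne_top
        calc ENNReal.ofReal η * wMass w Q
            = (ENNReal.ofReal Q.vol)⁻¹ * ENNReal.ofReal Q.vol * (ENNReal.ofReal η * wMass w Q) := by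
              rw [hcancel, one_mul]
          _ = (ENNReal.ofReal Q.vol)⁻¹ * wMass w Q * ENNReal.ofReal (η * Q.vol) := by
              rw [ENNReal.ofReal_mul hη.le]
              ring
    _ ≤ (ENNReal.ofReal Q.vol)⁻¹ * wMass w Q * volume E := by gcongr
    _ = ∫⁻ _ in E, (ENNReal.ofReal Q.vol)⁻¹ * wMass w Q := (setLIntegral_const _ _).symm
    _ ≤ ∫⁻ x in E, maximal (R.carrier.indicator w) x :=
        setLIntegral_mono' hE fun _ hx => average_le_maximal_indicator hw h (hEQ hx)

/-- The first half of the sparse Carleson embedding: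
`Σ_{Q∈S, Q⊆R} w(Q) ≤ η⁻¹ ∫_R M(1_R w)`. -/
lemma tsum_wMass_le_lintegral_maximal {η : ℝ} (hη : 0 < η) (hw : ∀ x, 0 ≤ w x)
    {S : Set (Cube n)} (hS : IsSparse η S) (R : Cube n) :
    (∑' Q : {Q : Cube n // Q ∈ S ∧ Q.carrier ⊆ R.carrier}, wMass w Q.1) ≤
      ENNReal.ofReal η⁻¹ * ∫⁻ x in R.carrier, maximal (R.carrier.indicator w) x := by
  obtain ⟨E, hEm, hEQ, hdisj, hvol⟩ := hS
  rw [ENNReal.tsum_eq_iSup_sum]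
  refine iSup_le fun F => ?_
  calc ∑ Q ∈ F, wMass w Q.1
      ≤ ∑ Q ∈ F, ENNReal.ofReal η⁻¹ * ∫⁻ x in E Q.1, maximal (R.carrier.indicator w) x :=
        Finset.sum_le_sum fun Q _ => wMass_le_lintegral_maximal hη hw Q.2.2 (hEm _ Q.2.1)
          (hEQ _ Q.2.1) (hvol _ Q.2.1)
    _ = ENNReal.ofReal η⁻¹ *
          ∫⁻ x in ⋃ Q ∈ F, E Q.1, maximal (R.carrier.indicator w) x := by
        rw [← Finset.mul_sum, lintegral_biUnion_finset _ fun Q _ => hEm _ Q.2.1]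
        exact fun Q _ Q' _ hne => hdisj Q.2.1 Q'.2.1 (Subtype.coe_ne_coe.2 hne)
    _ ≤ ENNReal.ofReal η⁻¹ * ∫⁻ x in R.carrier, maximal (R.carrier.indicator w) x := by
        gcongr
        exact iUnion₂_subset fun Q _ => (hEQ _ Q.2.1).trans Q.2.2

end SparseCarleson

/-- the sparse Carleson embedding for `A∞` weights:
`Σ_{Q∈S, Q⊆R} ω(Q) ≤ η⁻¹ [ω]_{A∞} ω(R)`. -/
theorem stmt10 (n : ℕ) (hn : 1 ≤ n) (η : ℝ) (hη : 0 < η) (hη1 : η ≤ 1)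
    (ω : (Fin n → ℝ) → ℝ) (hω : IsWeight ω) (hA : AinfChar ω < ∞)
    (S : Set (Cube n)) (hdy : ∀ Q ∈ S, Q.IsDyadic) (hS : IsSparse η S)
    (R : Cube n) :
    (∑' Q : {Q : Cube n // Q ∈ S ∧ Q.carrier ⊆ R.carrier}, wMass ω Q.1) ≤
      ENNReal.ofReal η⁻¹ * AinfChar ω * wMass ω R := by
  rcases eq_or_ne (wMass ω R) 0 with h0 | h0
  · have hzero : ∀ Q : {Q : Cube n // Q ∈ S ∧ Q.carrier ⊆ R.carrier}, wMass ω Q.1 = 0 :=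
      fun Q => le_antisymm ((wMass_mono Q.2.2).trans h0.le) zero_le
    simp [hzero]
  · refine (tsum_wMass_le_lintegral_maximal hη hω.2 hS R).trans ?_
    rw [mul_assoc]
    gcongr
    exact lintegral_maximal_le_AinfChar_mul hω h0
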